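/- If $A$, $B$, and $C$ are finite sets of integers, then $T(A,B,C) \le G(|A|,|B|,|C|) + \tfrac{1}{4}$. -/

import Mathlib

/-- `G x y z = ξη` if `ζ ≥ ξ + η`, and `ξη - (ξ+η-ζ)²/4` if `ζ ≤ ξ + η`,
where `(ξ, η, ζ)` is a non-decreasing rearrangement of `(x, y, z)`. -/
noncomputable def G (x y z : ℝ) : ℝ :=
  let ξ := min x (min y z)
  let ζ := max x (max y z)
  let η := x + y + z - ξ - ζ
  if ζ ≥ ξ + η then ξ * η else ξ * η - (ξ + η - ζ) ^ 2 / 4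

/-- `T A B C` is the number of triples `(a,b,c) ∈ A × B × C` with `a + b = 2c`. -/
def T (A B C : Finset ℤ) : ℕ :=
  ((A ×ˢ B ×ˢ C).filter (fun p => p.1 + p.2.1 = 2 * p.2.2)).card

lemma T_le_AB (A B C : Finset ℤ) : T A B C ≤ A.card * B.card := by
  rw [← Finset.card_product]
  apply Finset.card_le_card_of_injOn (fun p => (p.1, p.2.1))
  · intro p hp
    simp only [Finset.coe_filter, Finset.mem_product, Set.mem_setOf_eq] at hp
    simp [hp.1.1, hp.1.2.1]
  · rintro ⟨a, b, c⟩ hp ⟨a', b', c'⟩ hq h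
    simp at hp hq h ⊢
    omega

lemma T_le_AC (A B C : Finset ℤ) : T A B C ≤ A.card * C.card := by
  rw [← Finset.card_product]
  apply Finset.card_le_card_of_injOn (fun p => (p.1, p.2.2))
  · intro p hp
    simp only [Finset.coe_filter, Finset.mem_product, Set.mem_setOf_eq] at hp
    simp [hp.1.1, hp.1.2.2]
  · rintro ⟨a, b, c⟩ hp ⟨a', b', c'⟩ hq h
    simp at hp hq h ⊢
    omega

lemma T_le_BC (A B C : Finset ℤ) : T A B C ≤ B.card * C.card := by
  rw [← Finset.card_product]
  apply Finset.card_le_card_of_injOn (fun p => (p.2.1, p.2.2))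
  · intro p hp
    simp only [Finset.coe_filter, Finset.mem_product, Set.mem_setOf_eq] at hp
    simp [hp.1.2.1, hp.1.2.2]
  · rintro ⟨a, b, c⟩ hp ⟨a', b', c'⟩ hq h
    simp at hp hq h ⊢
    omega

/-- Removing the least element of `A` and the largest of `B` loses at most `|C|` solutions. -/
lemma T_step (A B C : Finset ℤ) (m M : ℤ) (hm : ∀ a ∈ A, m ≤ a) (hM : ∀ b ∈ B, b ≤ M) :
    T A B C ≤ C.card + T (A.erase m) (B.erase M) C := by
  have hook : (((A ×ˢ B ×ˢ C).filter (fun p => p.1 + p.2.1 = 2 * p.2.2)).filter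
      (fun p => p.1 = m ∨ p.2.1 = M)).card ≤ C.card := by
    apply Finset.card_le_card_of_injOn (fun p => p.2.2)
    · intro p hp
      simp only [Finset.coe_filter, Finset.mem_filter, Finset.mem_product, Set.mem_setOf_eq] at hp
      exact hp.1.1.2.2
    · rintro ⟨a, b, c⟩ hp ⟨a', b', c'⟩ hq h
      simp at hp hq h ⊢
      have h1 := hm a hp.1.1.1
      have h2 := hM b hp.1.1.2.1
      have h3 := hm a' hq.1.1.1
      have h4 := hM b' hq.1.1.2.1
      have h5 := hp.1.2
      have h6 := hq.1.2
      have h7 := hp.2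
      have h8 := hq.2
      omega
  unfold T
  rw [← Finset.card_filter_add_card_filter_not (fun p : ℤ × ℤ × ℤ => p.1 = m ∨ p.2.1 = M)]
  refine Nat.add_le_add hook (Finset.card_le_card ?_)
  rintro ⟨a, b, c⟩ hp
  simp at hp ⊢
  tauto

lemma T_le_t (C : Finset ℤ) (t : ℕ) : ∀ A B : Finset ℤ, t ≤ A.card → t ≤ B.card →
    T A B C ≤ t * C.card + (A.card - t) * (B.card - t) := by
  induction t with
  | zero => intro A B _ _; simpa using T_le_AB A B C
  | succ t ih =>
    intro A B hA hB
    have hAn : A.Nonempty := Finset.card_pos.mp (by omega)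
    have hBn : B.Nonempty := Finset.card_pos.mp (by omega)
    have h1 := T_step A B C (A.min' hAn) (B.max' hBn) (fun a ha => A.min'_le a ha)
      (fun b hb => B.le_max' b hb)
    have eA := Finset.card_erase_of_mem (A.min'_mem hAn)
    have eB := Finset.card_erase_of_mem (B.max'_mem hBn)
    have h2 := ih (A.erase (A.min' hAn)) (B.erase (B.max' hBn)) (by omega) (by omega)
    rw [eA, eB, Nat.sub_sub, Nat.sub_sub, Nat.add_comm 1 t] at h2
    rw [Nat.succ_mul]
    omega

/-- If `A`, `B`, `C` are finite sets of integers, then `T(A,B,C) ≤ G(|A|,|B|,|C|) + 1/4`. -/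
theorem stmt6 (A B C : Finset ℤ) :
    (T A B C : ℝ) ≤ G A.card B.card C.card + 1 / 4 := by
  have hAB : (T A B C : ℝ) ≤ A.card * B.card := by exact_mod_cast T_le_AB A B C
  have hAC : (T A B C : ℝ) ≤ A.card * C.card := by exact_mod_cast T_le_AC A B C
  have hBC : (T A B C : ℝ) ≤ B.card * C.card := by exact_mod_cast T_le_BC A B C
  have key : A.card ≤ B.card + C.card → B.card ≤ A.card + C.card → C.card ≤ A.card + B.card →
      (T A B C : ℝ) ≤ A.card * B.card - ((A.card : ℝ) + B.card - C.card) ^ 2 / 4 + 1 / 4 := by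
    intro h1 h2 h3
    obtain ⟨t, ht⟩ : ∃ t, t = (A.card + B.card - C.card) / 2 := ⟨_, rfl⟩
    have tA : t ≤ A.card := by omega
    have tB : t ≤ B.card := by omega
    have h := T_le_t C t A B tA tB
    have h' : (T A B C : ℝ) ≤ t * C.card + ((A.card : ℝ) - t) * ((B.card : ℝ) - t) := by
      rw [← Nat.cast_sub tA, ← Nat.cast_sub tB]
      exact_mod_cast h
    have hc : A.card + B.card = C.card + 2 * t ∨ A.card + B.card = C.card + 2 * t + 1 := by omega
    rcases hc with hc | hc
    · have hc' : (C.card : ℝ) = A.card + B.card - 2 * t := by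
        have : (A.card : ℝ) + B.card = C.card + 2 * t := by exact_mod_cast hc
        linarith
      rw [hc'] at h' ⊢
      nlinarith
    · have hc' : (C.card : ℝ) = A.card + B.card - 2 * t - 1 := by
        have : (A.card : ℝ) + B.card = C.card + 2 * t + 1 := by exact_mod_cast hc
        linarith
      rw [hc'] at h' ⊢
      nlinarith
  have key' : (A.card : ℝ) ≤ B.card + C.card → (B.card : ℝ) ≤ A.card + C.card →
      (C.card : ℝ) ≤ A.card + B.card →
      (T A B C : ℝ) ≤ A.card * B.card - ((A.card : ℝ) + B.card - C.card) ^ 2 / 4 + 1 / 4 := by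
    intro h1 h2 h3
    exact key (by exact_mod_cast h1) (by exact_mod_cast h2) (by exact_mod_cast h3)
  clear key
  have pA : (0 : ℝ) ≤ A.card := Nat.cast_nonneg _
  have pB : (0 : ℝ) ≤ B.card := Nat.cast_nonneg _
  have pC : (0 : ℝ) ≤ C.card := Nat.cast_nonneg _
  generalize (A.card : ℝ) = x at *
  generalize (B.card : ℝ) = y at *
  generalize (C.card : ℝ) = z at *
  unfold G
  rcases le_total x y with hxy | hxy <;> rcases le_total y z with hyz | hyz <;>
    rcases le_total x z with hxz | hxz <;>
    simp only [hxy, hyz, hxz, min_eq_left, min_eq_right, max_eq_left, max_eq_right] <;>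
    split_ifs with hif <;>
    first
    | nlinarith
    | (have hk := key' (by linarith) (by linarith) (by linarith)
       nlinarith)
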